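/- Let H = N⋊T be the smash product of cocommutative Hopf algebras N and T over a field k, acting trivially on the commutative k-algebra A. The map ι sending a measuring 1-cocycle f to the class of the Sweedler 2-cocycle (n⋊t)⊗(n'⋊t') ↦ ε(n) f(t)(n') ε(t') induces an injective group homomorphism H¹_meas(T,Hom(N,A)) → H̃²(H,A), and a class c ∈ H̃²(H,A) restricts to the trivial class in H²(N,A) if and only if c lies in the image of ι. -/

import Mathlib

open TensorProduct

namespace SmashPaper

variable (k : Type) [Field k]

section Conv

variable {k : Type} [Field k] {C A : Type} [AddCommGroup C] [Module k C] [Coalgebra k C]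
  [CommRing A] [Algebra k A]

/-- Convolution product on linear maps from a coalgebra to an algebra. -/
noncomputable def conv (f g : C →ₗ[k] A) : C →ₗ[k] A :=
  LinearMap.mul' k A ∘ₗ TensorProduct.map f g ∘ₗ Coalgebra.comul

/-- Convolution unit. -/
noncomputable def convOne (C A : Type) [AddCommGroup C] [Module k C] [Coalgebra k C]
    [CommRing A] [Algebra k A] : C →ₗ[k] A :=
  Algebra.linearMap k A ∘ₗ Coalgebra.counit

def IsConvInv (f g : C →ₗ[k] A) : Prop :=
  conv f g = convOne C A ∧ conv g f = convOne C A

def IsConvInvertible (f : C →ₗ[k] A) : Prop := ∃ g, IsConvInv f g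

end Conv

/-- Cocommutativity of a coalgebra. -/
def IsCocomm (C : Type) [AddCommGroup C] [Module k C] [Coalgebra k C] : Prop :=
  (TensorProduct.comm k C C).toLinearMap ∘ₗ Coalgebra.comul
    = (Coalgebra.comul : C →ₗ[k] C ⊗[k] C)

section Drop

variable {k : Type} [Field k] (C D : Type) [AddCommGroup C] [Module k C]
  [AddCommGroup D] [Module k D]

/-- `c ⊗ d ↦ ε(c) d`. -/
noncomputable def dropL [Coalgebra k C] : C ⊗[k] D →ₗ[k] D :=
  (TensorProduct.lid k D).toLinearMap ∘ₗ LinearMap.rTensor D (Coalgebra.counit (R := k))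

/-- `c ⊗ d ↦ ε(d) c`. -/
noncomputable def dropR [Coalgebra k D] : C ⊗[k] D →ₗ[k] C :=
  (TensorProduct.rid k C).toLinearMap ∘ₗ LinearMap.lTensor C (Coalgebra.counit (R := k))

end Drop

section Sweedler

variable {k : Type} [Field k] (H A : Type) [Ring H] [Bialgebra k H]
  [CommRing A] [Algebra k A]

variable {H A}

/-- Normalization for 1-cochains. -/
def Normalized1 (t : H →ₗ[k] A) : Prop := t 1 = 1

/-- Normalization for 2-cochains: trivial whenever an argument is a scalar. -/
def Normalized2 (f : H ⊗[k] H →ₗ[k] A) : Prop :=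
  ∀ x : H, f (1 ⊗ₜ[k] x) = algebraMap k A (Coalgebra.counit x)
    ∧ f (x ⊗ₜ[k] 1) = algebraMap k A (Coalgebra.counit x)

/-- Normalization for 3-cochains. -/
def Normalized3 (f : (H ⊗[k] H) ⊗[k] H →ₗ[k] A) : Prop :=
  ∀ x y : H,
    f ((1 ⊗ₜ[k] x) ⊗ₜ[k] y) = algebraMap k A (Coalgebra.counit x * Coalgebra.counit y)
    ∧ f ((x ⊗ₜ[k] 1) ⊗ₜ[k] y) = algebraMap k A (Coalgebra.counit x * Coalgebra.counit y)
    ∧ f ((x ⊗ₜ[k] y) ⊗ₜ[k] 1) = algebraMap k A (Coalgebra.counit x * Coalgebra.counit y)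

/-- `∑ f(x₍₁₎ ⊗ y₍₁₎) f(x₍₂₎y₍₂₎ ⊗ z)` as a linear map on `(H ⊗ H) ⊗ H`. -/
noncomputable def cocycle2LHS (f : H ⊗[k] H →ₗ[k] A) : (H ⊗[k] H) ⊗[k] H →ₗ[k] A :=
  conv (f ∘ₗ dropR (H ⊗[k] H) H) (f ∘ₗ LinearMap.rTensor H (LinearMap.mul' k H))

/-- `∑ f(y₍₁₎ ⊗ z₍₁₎) f(x ⊗ y₍₂₎z₍₂₎)` as a linear map on `(H ⊗ H) ⊗ H`. -/
noncomputable def cocycle2RHS (f : H ⊗[k] H →ₗ[k] A) : (H ⊗[k] H) ⊗[k] H →ₗ[k] A :=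
  conv (f ∘ₗ dropL H (H ⊗[k] H) ∘ₗ (TensorProduct.assoc k H H H).toLinearMap)
       (f ∘ₗ LinearMap.lTensor H (LinearMap.mul' k H) ∘ₗ (TensorProduct.assoc k H H H).toLinearMap)

/-- Sweedler 2-cocycles (for the trivial action). -/
def IsZ2 (f : H ⊗[k] H →ₗ[k] A) : Prop :=
  Normalized2 f ∧ IsConvInvertible f ∧ cocycle2LHS f = cocycle2RHS f

/-- The Sweedler 2-coboundary `∑ t(y₍₁₎) t⁻¹(x₍₁₎y₍₂₎) t(x₍₂₎)` of a 1-cochain `t`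
with convolution inverse `tinv`. -/
noncomputable def cobound2 (t tinv : H →ₗ[k] A) : H ⊗[k] H →ₗ[k] A :=
  conv (t ∘ₗ dropL H H) (conv (tinv ∘ₗ LinearMap.mul' k H) (t ∘ₗ dropR H H))

/-- Sweedler 2-coboundaries (for the trivial action). -/
def IsB2 (f : H ⊗[k] H →ₗ[k] A) : Prop :=
  ∃ t tinv : H →ₗ[k] A, Normalized1 t ∧ IsConvInv t tinv ∧ f = cobound2 t tinv

/-- Two 2-cochains are cohomologous when they differ (in convolution) by a 2-coboundary. -/
def Cohomologous2 (f f' : H ⊗[k] H →ₗ[k] A) : Prop :=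
  ∃ b, IsB2 b ∧ f = conv f' b

/-- `(x⊗y)⊗z ↦ x ⊗ yz`. -/
noncomputable def m23 : (H ⊗[k] H) ⊗[k] H →ₗ[k] H ⊗[k] H :=
  LinearMap.lTensor H (LinearMap.mul' k H) ∘ₗ (TensorProduct.assoc k H H H).toLinearMap

/-- `(x⊗y)⊗z ↦ ε(x) (y⊗z)`. -/
noncomputable def p23 : (H ⊗[k] H) ⊗[k] H →ₗ[k] H ⊗[k] H :=
  dropL H (H ⊗[k] H) ∘ₗ (TensorProduct.assoc k H H H).toLinearMap

/-- 3-cocycle condition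
`∑ f(y₁⊗z₁⊗w₁) f(x₁⊗y₂z₂⊗w₂) f(x₂⊗y₃⊗z₃) = ∑ f(x₁y₁⊗z₁⊗w₁) f(x₂⊗y₂⊗z₂w₂)`. -/
def IsZ3cond (f : (H ⊗[k] H) ⊗[k] H →ₗ[k] A) : Prop :=
  conv (f ∘ₗ LinearMap.rTensor H (LinearMap.rTensor H (dropL H H)))
    (conv (f ∘ₗ LinearMap.rTensor H (m23 (H := H)))
          (f ∘ₗ dropR ((H ⊗[k] H) ⊗[k] H) H))
  = conv (C := ((H ⊗[k] H) ⊗[k] H) ⊗[k] H)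
         (f ∘ₗ LinearMap.rTensor H (LinearMap.rTensor H (LinearMap.mul' k H)))
         (f ∘ₗ (LinearMap.lTensor (H ⊗[k] H) (LinearMap.mul' k H)
              ∘ₗ (TensorProduct.assoc k (H ⊗[k] H) H H).toLinearMap :
                ((H ⊗[k] H) ⊗[k] H) ⊗[k] H →ₗ[k] (H ⊗[k] H) ⊗[k] H))

/-- Sweedler 3-cocycles (for the trivial action). -/
def IsZ3 (f : (H ⊗[k] H) ⊗[k] H →ₗ[k] A) : Prop :=
  Normalized3 f ∧ IsConvInvertible f ∧ IsZ3cond f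

/-- The Sweedler 3-coboundary
`∑ v(y₁⊗z₁) v⁻¹(x₁y₂⊗z₂) v(x₂⊗y₃z₃) v⁻¹(x₃⊗y₄)` of a 2-cochain `v`. -/
noncomputable def cobound3 (v vinv : H ⊗[k] H →ₗ[k] A) : (H ⊗[k] H) ⊗[k] H →ₗ[k] A :=
  conv (v ∘ₗ p23 (H := H))
    (conv (vinv ∘ₗ LinearMap.rTensor H (LinearMap.mul' k H))
      (conv (v ∘ₗ m23 (H := H)) (vinv ∘ₗ dropR (H ⊗[k] H) H)))

/-- Sweedler 3-coboundaries (for the trivial action). -/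
def IsB3 (f : (H ⊗[k] H) ⊗[k] H →ₗ[k] A) : Prop :=
  ∃ v vinv : H ⊗[k] H →ₗ[k] A, Normalized2 v ∧ IsConvInv v vinv ∧ f = cobound3 v vinv

/-- Cohomologous 3-cochains. -/
def Cohomologous3 (f f' : (H ⊗[k] H) ⊗[k] H →ₗ[k] A) : Prop :=
  ∃ b, IsB3 b ∧ f = conv f' b

end Sweedler

section Measuring

variable {k : Type} [Field k]
variable {C : Type} [AddCommGroup C] [Module k C] [Coalgebra k C]
variable {N : Type} [Ring N] [Bialgebra k N]
variable {A : Type} [CommRing A] [Algebra k A]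

/-- `(C, θ)` measures `N` to `A`:
`∑ θ(c₍₁₎ ⊗ n) θ(c₍₂₎ ⊗ n') = θ(c ⊗ nn')` and `θ(c ⊗ 1) = ε(c) 1`. -/
def Measures (θ : C ⊗[k] N →ₗ[k] A) : Prop :=
  (θ ∘ₗ LinearMap.lTensor C (LinearMap.mul' k N)
    = conv (θ ∘ₗ LinearMap.lTensor C (dropR N N)) (θ ∘ₗ LinearMap.lTensor C (dropL N N)))
  ∧ ∀ c : C, θ (c ⊗ₜ[k] (1 : N)) = algebraMap k A (Coalgebra.counit c)

end Measuring

section Action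

variable {k : Type} [Field k]
variable {T N : Type} [Ring T] [Bialgebra k T] [Ring N] [Bialgebra k N]

/-- `μ : T ⊗ N → N` makes `N` a left `T`-module bialgebra. -/
structure IsModuleBialgebra (μ : T ⊗[k] N →ₗ[k] N) : Prop where
  one_act : ∀ n : N, μ ((1 : T) ⊗ₜ[k] n) = n
  mul_act : ∀ (t s : T) (n : N), μ ((t * s) ⊗ₜ[k] n) = μ (t ⊗ₜ[k] μ (s ⊗ₜ[k] n))
  act_one : ∀ t : T, μ (t ⊗ₜ[k] (1 : N)) = algebraMap k N (Coalgebra.counit t)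
  act_mul : μ ∘ₗ LinearMap.lTensor T (LinearMap.mul' k N)
      = LinearMap.mul' k N ∘ₗ TensorProduct.map μ μ
          ∘ₗ (TensorProduct.tensorTensorTensorComm k T T N N).toLinearMap
          ∘ₗ LinearMap.rTensor (N ⊗[k] N) Coalgebra.comul
  comul_act : Coalgebra.comul ∘ₗ μ
      = TensorProduct.map μ μ
          ∘ₗ (TensorProduct.tensorTensorTensorComm k T T N N).toLinearMap
          ∘ₗ TensorProduct.map Coalgebra.comul Coalgebra.comul
  counit_act : ∀ (t : T) (n : N),
      Coalgebra.counit (R := k) (μ (t ⊗ₜ[k] n))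
        = Coalgebra.counit (R := k) t * Coalgebra.counit (R := k) n

/-- `t ⊗ n ↦ ∑ t₍₁₎(n) ⊗ t₍₂₎`. -/
noncomputable def smashCross (μ : T ⊗[k] N →ₗ[k] N) : T ⊗[k] N →ₗ[k] N ⊗[k] T :=
  TensorProduct.map μ LinearMap.id
    ∘ₗ (TensorProduct.assoc k T N T).symm.toLinearMap
    ∘ₗ LinearMap.lTensor T (TensorProduct.comm k T N).toLinearMap
    ∘ₗ (TensorProduct.assoc k T T N).toLinearMap
    ∘ₗ LinearMap.rTensor N Coalgebra.comul

variable {H : Type} [Ring H] [Bialgebra k H]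

/-- `H` is the smash product `N ⋊ T` along the action `μ`, with `N` and `T` included
as the Hopf subalgebras `N ⋊ 1` and `1 ⋊ T`; we identify `n ⋊ t = n t`. -/
structure IsSmashProduct (μ : T ⊗[k] N →ₗ[k] N) (iN : N →ₐc[k] H) (iT : T →ₐc[k] H) : Prop where
  act : IsModuleBialgebra μ
  injN : Function.Injective iN
  injT : Function.Injective iT
  /-- `n ⊗ t ↦ (n ⋊ 1)(1 ⋊ t)` is a linear isomorphism `N ⊗ T ≅ H` (`H` is the
  tensor product coalgebra `N ⊗ T`). -/
  bij : Function.Bijective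
    (LinearMap.mul' k H ∘ₗ TensorProduct.map (iN : N →ₗ[k] H) (iT : T →ₗ[k] H))
  /-- The smash relation `t n = ∑ t₍₁₎(n) t₍₂₎` in `H`. -/
  straighten : LinearMap.mul' k H ∘ₗ TensorProduct.map (iT : T →ₗ[k] H) (iN : N →ₗ[k] H)
      = LinearMap.mul' k H ∘ₗ TensorProduct.map (iN : N →ₗ[k] H) (iT : T →ₗ[k] H)
          ∘ₗ smashCross μ

end Action

section MeasCohomology

variable {k : Type} [Field k]
variable {T N : Type} [Ring T] [Bialgebra k T] [Ring N] [Bialgebra k N]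
variable {A : Type} [CommRing A] [Algebra k A]

/-- Normalization in the `T`-variable for measuring 1-cochains `T ⊗ N → A`. -/
def MeasNormalized1 (f : T ⊗[k] N →ₗ[k] A) : Prop :=
  ∀ n : N, f ((1 : T) ⊗ₜ[k] n) = algebraMap k A (Coalgebra.counit n)

/-- A measuring 1-cochain: an element of `Reg_meas(T, Hom(N,A))`. -/
def IsRegMeas1 (f : T ⊗[k] N →ₗ[k] A) : Prop :=
  Measures f ∧ MeasNormalized1 f ∧ IsConvInvertible f

/-- The measuring 1-cocycle condition `f(ts)(n) = ∑ f(s₍₁₎)(n₍₁₎) f(t)(s₍₂₎(n₍₂₎))`. -/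
def MeasCocycle1 (μ : T ⊗[k] N →ₗ[k] N) (f : T ⊗[k] N →ₗ[k] A) : Prop :=
  f ∘ₗ LinearMap.rTensor N (LinearMap.mul' k T)
    = conv (f ∘ₗ LinearMap.rTensor N (dropL T T))
      (f ∘ₗ LinearMap.lTensor T μ ∘ₗ (TensorProduct.assoc k T T N).toLinearMap)

/-- Measuring 1-cocycles. -/
def IsMeasZ1 (μ : T ⊗[k] N →ₗ[k] N) (f : T ⊗[k] N →ₗ[k] A) : Prop :=
  IsRegMeas1 f ∧ MeasCocycle1 μ f

/-- Measuring 1-coboundaries: `f(t)(n) = ∑ g(n₍₁₎) g⁻¹(t(n₍₂₎))` for a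
convolution-invertible algebra map `g : N → A`. -/
def IsMeasB1 (μ : T ⊗[k] N →ₗ[k] N) (f : T ⊗[k] N →ₗ[k] A) : Prop :=
  ∃ (g : N →ₐ[k] A) (ginv : N →ₗ[k] A), IsConvInv g.toLinearMap ginv ∧
    f = conv (g.toLinearMap ∘ₗ dropL T N) (ginv ∘ₗ μ)

/-- Normalization for measuring 2-cochains `(T ⊗ T) ⊗ N → A`. -/
def MeasNormalized2 (f : (T ⊗[k] T) ⊗[k] N →ₗ[k] A) : Prop :=
  ∀ (t : T) (n : N),
    f (((1 : T) ⊗ₜ[k] t) ⊗ₜ[k] n)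
        = algebraMap k A (Coalgebra.counit t * Coalgebra.counit n)
    ∧ f ((t ⊗ₜ[k] (1 : T)) ⊗ₜ[k] n)
        = algebraMap k A (Coalgebra.counit t * Coalgebra.counit n)

/-- A measuring 2-cochain: an element of `Reg_meas(T ⊗ T, Hom(N,A))`. -/
def IsRegMeas2 (f : (T ⊗[k] T) ⊗[k] N →ₗ[k] A) : Prop :=
  Measures f ∧ MeasNormalized2 f ∧ IsConvInvertible f

/-- The measuring 2-cocycle condition
`∑ f(t₍₁₎⊗s₍₁₎)(r₍₁₎(n₍₁₎)) f(t₍₂₎s₍₂₎⊗r₍₂₎)(n₍₂₎) = ∑ f(s₍₁₎⊗r₍₁₎)(n₍₁₎) f(t⊗s₍₂₎r₍₂₎)(n₍₂₎)`. -/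
def MeasCocycle2 (μ : T ⊗[k] N →ₗ[k] N) (f : (T ⊗[k] T) ⊗[k] N →ₗ[k] A) : Prop :=
  conv (C := ((T ⊗[k] T) ⊗[k] T) ⊗[k] N)
       (f ∘ₗ (LinearMap.lTensor (T ⊗[k] T) μ
          ∘ₗ (TensorProduct.assoc k (T ⊗[k] T) T N).toLinearMap :
            ((T ⊗[k] T) ⊗[k] T) ⊗[k] N →ₗ[k] (T ⊗[k] T) ⊗[k] N))
       (f ∘ₗ LinearMap.rTensor N (LinearMap.rTensor T (LinearMap.mul' k T)))
    = conv (C := ((T ⊗[k] T) ⊗[k] T) ⊗[k] N)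
           (f ∘ₗ LinearMap.rTensor N (LinearMap.rTensor T (dropL T T)))
           (f ∘ₗ LinearMap.rTensor N
              ((LinearMap.lTensor T (LinearMap.mul' k T)
                ∘ₗ (TensorProduct.assoc k T T T).toLinearMap :
                  (T ⊗[k] T) ⊗[k] T →ₗ[k] T ⊗[k] T)))

/-- Measuring 2-cocycles. -/
def IsMeasZ2 (μ : T ⊗[k] N →ₗ[k] N) (f : (T ⊗[k] T) ⊗[k] N →ₗ[k] A) : Prop :=
  IsRegMeas2 f ∧ MeasCocycle2 μ f

/-- The measuring coboundary
`(t ⊗ s ⊗ n) ↦ ∑ g(s₍₁₎)(n₍₁₎) g⁻¹(t₍₁₎s₍₂₎)(n₍₂₎) g(t₍₂₎)(s₍₃₎(n₍₃₎))`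
of a 1-cochain `g` with convolution inverse `ginv`.  (For a 2-cocycle `f` on `N` with
stability witness `g`, this same formula is the map `d`. ) -/
noncomputable def measCobound (μ : T ⊗[k] N →ₗ[k] N) (g ginv : T ⊗[k] N →ₗ[k] A) :
    (T ⊗[k] T) ⊗[k] N →ₗ[k] A :=
  conv (g ∘ₗ LinearMap.rTensor N (dropL T T))
    (conv (ginv ∘ₗ LinearMap.rTensor N (LinearMap.mul' k T))
          (g ∘ₗ LinearMap.lTensor T μ ∘ₗ (TensorProduct.assoc k T T N).toLinearMap))

/-- Measuring 2-coboundaries. -/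
def IsMeasB2 (μ : T ⊗[k] N →ₗ[k] N) (f : (T ⊗[k] T) ⊗[k] N →ₗ[k] A) : Prop :=
  ∃ g ginv : T ⊗[k] N →ₗ[k] A, IsRegMeas1 g ∧ IsConvInv g ginv ∧ f = measCobound μ g ginv

/-- Cohomologous measuring 2-cochains. -/
def MeasCohomologous2 (μ : T ⊗[k] N →ₗ[k] N) (f f' : (T ⊗[k] T) ⊗[k] N →ₗ[k] A) : Prop :=
  ∃ b, IsMeasB2 μ b ∧ f = conv f' b

/-- `∑ f(n₍₁₎ ⊗ n'₍₁₎) f⁻¹(t₍₁₎(n₍₂₎) ⊗ t₍₂₎(n'₍₂₎))` as a map `T ⊗ (N ⊗ N) → A`. -/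
noncomputable def stabLHS (μ : T ⊗[k] N →ₗ[k] N) (f finv : N ⊗[k] N →ₗ[k] A) :
    T ⊗[k] (N ⊗[k] N) →ₗ[k] A :=
  conv (f ∘ₗ dropL T (N ⊗[k] N))
       (finv ∘ₗ TensorProduct.map μ μ
          ∘ₗ (TensorProduct.tensorTensorTensorComm k T T N N).toLinearMap
          ∘ₗ LinearMap.rTensor (N ⊗[k] N) Coalgebra.comul)

/-- `∑ g(t₍₁₎ ⊗ n₍₁₎) g⁻¹(t₍₂₎ ⊗ n₍₂₎n'₍₁₎) g(t₍₃₎ ⊗ n'₍₂₎)` as a map `T ⊗ (N ⊗ N) → A`. -/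
noncomputable def stabRHS (g ginv : T ⊗[k] N →ₗ[k] A) : T ⊗[k] (N ⊗[k] N) →ₗ[k] A :=
  conv (g ∘ₗ LinearMap.lTensor T (dropR N N))
    (conv (ginv ∘ₗ LinearMap.lTensor T (LinearMap.mul' k N))
          (g ∘ₗ LinearMap.lTensor T (dropL N N)))

/-- `g` (with convolution inverse `ginv`) witnesses the `T`-stability of the
2-cochain `f` on `N` (with convolution inverse `finv`):
`f * (f⁻¹)ᵗ = δ'(g(t ⊗ _))`. -/
def IsStabilityWitness (μ : T ⊗[k] N →ₗ[k] N) (f finv : N ⊗[k] N →ₗ[k] A)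
    (g ginv : T ⊗[k] N →ₗ[k] A) : Prop :=
  MeasNormalized1 g ∧ (∀ t : T, g (t ⊗ₜ[k] (1 : N)) = algebraMap k A (Coalgebra.counit t))
    ∧ IsConvInv g ginv ∧ stabLHS μ f finv = stabRHS g ginv

/-- The cohomology class of the 2-cocycle `f` on `N` is `T`-stable. -/
def IsTStable (μ : T ⊗[k] N →ₗ[k] N) (f finv : N ⊗[k] N →ₗ[k] A) : Prop :=
  ∃ g ginv, IsStabilityWitness μ f finv g ginv

end MeasCohomology

section SmashStatements

variable {k : Type} [Field k]
variable {T N H A : Type} [Ring T] [Bialgebra k T] [Ring N] [Bialgebra k N]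
  [Ring H] [Bialgebra k H] [CommRing A] [Algebra k A]

/-- `n ⊗ t ↦ (n ⋊ 1)(1 ⋊ t) = n ⋊ t`. -/
noncomputable def smashMul (iN : N →ₐc[k] H) (iT : T →ₐc[k] H) : N ⊗[k] T →ₗ[k] H :=
  LinearMap.mul' k H ∘ₗ TensorProduct.map iN.toLinearMap iT.toLinearMap

/-- The restriction of a 2-cochain on `H` to `N ⊗ N`. -/
noncomputable def resNN (iN : N →ₐc[k] H) (f : H ⊗[k] H →ₗ[k] A) : N ⊗[k] N →ₗ[k] A :=
  f ∘ₗ TensorProduct.map iN.toLinearMap iN.toLinearMap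

/-- The restriction of a 2-cochain on `H` to `T ⊗ T`. -/
noncomputable def resTT (iT : T →ₐc[k] H) (f : H ⊗[k] H →ₗ[k] A) : T ⊗[k] T →ₗ[k] A :=
  f ∘ₗ TensorProduct.map iT.toLinearMap iT.toLinearMap

/-- The restriction of a 2-cochain on `H` to `T ⊗ N`. -/
noncomputable def resTN (iN : N →ₐc[k] H) (iT : T →ₐc[k] H) (f : H ⊗[k] H →ₗ[k] A) :
    T ⊗[k] N →ₗ[k] A :=
  f ∘ₗ TensorProduct.map iT.toLinearMap iN.toLinearMap

/-- `f` is trivial on `N ⊗ T`: `f(n ⊗ t) = ε(n)ε(t)1`. -/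
def TrivialOnNT (iN : N →ₐc[k] H) (iT : T →ₐc[k] H) (f : H ⊗[k] H →ₗ[k] A) : Prop :=
  ∀ (n : N) (t : T), f (iN n ⊗ₜ[k] iT t)
    = algebraMap k A (Coalgebra.counit n * Coalgebra.counit t)

/-- `f` is trivial on `T ⊗ T`. -/
def TrivialOnTT (iT : T →ₐc[k] H) (f : H ⊗[k] H →ₗ[k] A) : Prop :=
  ∀ t t' : T, f (iT t ⊗ₜ[k] iT t')
    = algebraMap k A (Coalgebra.counit t * Coalgebra.counit t')

/-- `F` is the 2-cochain `ι f : (n ⋊ t) ⊗ (n' ⋊ t') ↦ ε(n) f(t)(n') ε(t')` on `H`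
associated with a measuring 1-cochain `f`. -/
def IotaOf (iN : N →ₐc[k] H) (iT : T →ₐc[k] H) (f : T ⊗[k] N →ₗ[k] A)
    (F : H ⊗[k] H →ₗ[k] A) : Prop :=
  ∀ (n : N) (t : T) (n' : N) (t' : T),
    F ((iN n * iT t) ⊗ₜ[k] (iN n' * iT t'))
      = algebraMap k A (Coalgebra.counit n * Coalgebra.counit t') * f (t ⊗ₜ[k] n')

/-- `J` is the 3-cochain
`jf : (n⋊t) ⊗ (n'⋊t') ⊗ (n''⋊t'') ↦ ε(n)ε(n') f(t⊗t')(n'') ε(t'')` on `H`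
associated with a measuring 2-cochain `f`. -/
def JOf (iN : N →ₐc[k] H) (iT : T →ₐc[k] H) (f : (T ⊗[k] T) ⊗[k] N →ₗ[k] A)
    (J : (H ⊗[k] H) ⊗[k] H →ₗ[k] A) : Prop :=
  ∀ (n : N) (t : T) (n' : N) (t' : T) (n'' : N) (t'' : T),
    J (((iN n * iT t) ⊗ₜ[k] (iN n' * iT t')) ⊗ₜ[k] (iN n'' * iT t''))
      = algebraMap k A (Coalgebra.counit n * Coalgebra.counit n' * Coalgebra.counit t'')
          * f ((t ⊗ₜ[k] t') ⊗ₜ[k] n'')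

end SmashStatements

end SmashPaper

open TensorProduct SmashPaper

namespace SmashPaper

section Points

open Coalgebra WithConv

variable {k : Type} [Field k]
variable {X Y C D E : Type} [AddCommGroup X] [Module k X] [Coalgebra k X]
  [AddCommGroup Y] [Module k Y] [Coalgebra k Y]
  [AddCommGroup C] [Module k C] [Coalgebra k C] [AddCommGroup D] [Module k D] [Coalgebra k D]
  [AddCommGroup E] [Module k E] [Coalgebra k E]

variable (k C D) in
/-- The first projection `C ⊗ D → C` as a coalgebra map. -/
noncomputable def fstC : C ⊗[k] D →ₗc[k] C :=
  (Coalgebra.TensorProduct.rid k k C).toCoalgHom.comp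
    (Coalgebra.TensorProduct.map (CoalgHom.id k C) (Coalgebra.counitCoalgHom k D))

variable (k C D) in
/-- The second projection `C ⊗ D → D` as a coalgebra map. -/
noncomputable def sndC : C ⊗[k] D →ₗc[k] D :=
  (Coalgebra.TensorProduct.lid k D).toCoalgHom.comp
    (Coalgebra.TensorProduct.map (Coalgebra.counitCoalgHom k C) (CoalgHom.id k D))

@[simp] lemma fstC_tmul (c : C) (d : D) :
    (fstC k C D) (c ⊗ₜ d) = counit (R := k) d • c := rfl

@[simp] lemma sndC_tmul (c : C) (d : D) :
    (sndC k C D) (c ⊗ₜ d) = counit (R := k) c • d := rfl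

lemma coalgHom_ext_tmul {g h : C ⊗[k] D →ₗc[k] E} (H : ∀ c d, g (c ⊗ₜ d) = h (c ⊗ₜ d)) :
    g = h :=
  CoalgHom.coe_linearMap_injective (TensorProduct.ext' H)

lemma coalgHom_ext_tmul₃ {g h : (C ⊗[k] D) ⊗[k] E →ₗc[k] X}
    (H : ∀ c d e, g ((c ⊗ₜ d) ⊗ₜ e) = h ((c ⊗ₜ d) ⊗ₜ e)) : g = h :=
  CoalgHom.coe_linearMap_injective (TensorProduct.ext_threefold H)

lemma dropL_comul (c : C) : dropL C C (comul (R := k) c) = c := by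
  simp [dropL]

lemma dropR_comul (c : C) : dropR C C (comul (R := k) c) = c := by
  simp [dropR]

lemma map_fstC_sndC_comul (z : C ⊗[k] D) :
    TensorProduct.map (fstC k C D).toLinearMap
      (sndC k C D).toLinearMap (comul (R := k) z) = z := by
  induction z with
  | zero => simp
  | add x y hx hy => simp only [map_add, hx, hy]
  | tmul c d =>
    have key : ∀ (p : C ⊗[k] C) (q : D ⊗[k] D),
        TensorProduct.map (fstC k C D).toLinearMap
          (sndC k C D).toLinearMap
          (TensorProduct.tensorTensorTensorComm k C C D D (p ⊗ₜ q))
        = dropR C C p ⊗ₜ dropL D D q := by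
      intro p q
      induction p with
      | zero => simp
      | add x y hx hy => simp only [TensorProduct.add_tmul, map_add, hx, hy]
      | tmul a b =>
        induction q with
        | zero => simp
        | add x y hx hy => simp only [TensorProduct.tmul_add, map_add, hx, hy]
        | tmul a' b' =>
          simp [dropL, dropR, TensorProduct.smul_tmul, TensorProduct.tmul_smul,
            smul_comm (counit (R := k) b)]
    refine (key (comul c) (comul d)).trans ?_
    rw [dropR_comul, dropL_comul]

section

variable [Coalgebra.IsCocomm k X]

/-- The pairing of two `X`-points. -/
noncomputable def pair (x : X →ₗc[k] C) (y : X →ₗc[k] D) : X →ₗc[k] C ⊗[k] D :=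
  (Coalgebra.TensorProduct.map x y).comp (Coalgebra.comulCoalgHom k X)

lemma pair_apply (x : X →ₗc[k] C) (y : X →ₗc[k] D) (a : X) :
    pair x y a = TensorProduct.map x.toLinearMap y.toLinearMap (comul a) := rfl

lemma pair_fstC_sndC (g : X →ₗc[k] C ⊗[k] D) :
    pair ((fstC k _ _).comp g) ((sndC k _ _).comp g) = g := by
  ext a
  rw [pair_apply]
  conv_rhs => rw [← map_fstC_sndC_comul (g a), ← CoalgHomClass.map_comp_comul_apply]
  generalize comul (R := k) a = z
  induction z with
  | zero => simp
  | add x y hx hy => simp only [map_add, hx, hy]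
  | tmul c d => simp

lemma fstC_comp_pair (x : X →ₗc[k] C) (y : X →ₗc[k] D) : (fstC k _ _).comp (pair x y) = x := by
  ext a
  conv_rhs => rw [← dropR_comul (k := k) a]
  rw [CoalgHom.comp_apply, pair_apply]
  generalize comul (R := k) a = z
  induction z with
  | zero => simp
  | add x y hx hy => simp only [map_add, hx, hy]
  | tmul c d => simp [dropR]

lemma sndC_comp_pair (x : X →ₗc[k] C) (y : X →ₗc[k] D) : (sndC k _ _).comp (pair x y) = y := by
  ext a
  conv_rhs => rw [← dropL_comul (k := k) a]
  rw [CoalgHom.comp_apply, pair_apply]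
  generalize comul (R := k) a = z
  induction z with
  | zero => simp
  | add x y hx hy => simp only [map_add, hx, hy]
  | tmul c d => simp [dropL]

lemma pair_comp [Coalgebra.IsCocomm k Y] (x : X →ₗc[k] C) (y : X →ₗc[k] D) (g : Y →ₗc[k] X) :
    (pair x y).comp g = pair (x.comp g) (y.comp g) := by
  rw [← pair_fstC_sndC ((pair x y).comp g), ← CoalgHom.comp_assoc, ← CoalgHom.comp_assoc,
    fstC_comp_pair, sndC_comp_pair]

lemma pair_eq {x : X →ₗc[k] C} {y : X →ₗc[k] D} {g : X →ₗc[k] C ⊗[k] D}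
    (h₁ : (fstC k _ _).comp g = x) (h₂ : (sndC k _ _).comp g = y) : pair x y = g := by
  rw [← h₁, ← h₂, pair_fstC_sndC]

end

end Points

end SmashPaper

namespace SmashPaper

section Products

open Coalgebra WithConv

variable {k : Type} [Field k]
variable {X Y C D E : Type} [AddCommGroup X] [Module k X] [Coalgebra k X]
  [AddCommGroup Y] [Module k Y] [Coalgebra k Y]
  [AddCommGroup C] [Module k C] [Coalgebra k C] [AddCommGroup D] [Module k D] [Coalgebra k D]
  [AddCommGroup E] [Module k E] [Coalgebra k E]
variable {H N : Type} [Ring H] [Bialgebra k H] [Ring N] [Bialgebra k N]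

/-- The neutral `X`-point of a bialgebra. -/
noncomputable def cone : X →ₗc[k] H :=
  (Bialgebra.unitBialgHom k H).toCoalgHom.comp (Coalgebra.counitCoalgHom k X)

@[simp] lemma cone_apply (a : X) :
    (cone : X →ₗc[k] H) a = algebraMap k H (counit a) := rfl

@[simp] lemma cone_comp (g : Y →ₗc[k] X) : (cone : X →ₗc[k] H).comp g = cone := by
  ext a
  simp

@[simp] lemma bialgHom_comp_cone (i : N →ₐc[k] H) :
    i.toCoalgHom.comp (cone : X →ₗc[k] N) = cone := by
  ext a
  exact AlgHomClass.commutes i _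

lemma toConv_cone : toConv (cone : X →ₗc[k] H).toLinearMap = 1 := rfl

lemma toConv_toLinearMap_injective {x y : X →ₗc[k] H}
    (h : toConv x.toLinearMap = toConv y.toLinearMap) : x = y :=
  CoalgHom.coe_linearMap_injective (toConv_injective h)

variable {A : Type} [CommRing A] [Algebra k A]

variable (X A) in
/-- The group of convolution-invertible maps `X → A`. -/
abbrev Reg : Type := (WithConv (X →ₗ[k] A))ˣ

/-- The linear map underlying a convolution-invertible map. -/
def Reg.lin (u : Reg (k := k) X A) : X →ₗ[k] A := u.val.ofConv

lemma Reg.lin_injective {u v : Reg (k := k) X A} (h : u.lin = v.lin) : u = v :=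
  Units.ext (ofConv_injective h)

lemma Reg.lin_mul (u v : Reg (k := k) X A) : (u * v).lin = conv u.lin v.lin := rfl

lemma Reg.lin_one : (1 : Reg (k := k) X A).lin = convOne X A := rfl

lemma Reg.isConvInv (u : Reg (k := k) X A) : IsConvInv u.lin u⁻¹.lin :=
  ⟨congrArg ofConv u.mul_inv, congrArg ofConv u.inv_mul⟩

lemma exists_reg_of_isConvInv {f g : X →ₗ[k] A} (h : IsConvInv f g) :
    ∃ u : Reg (k := k) X A, u.lin = f ∧ u⁻¹.lin = g :=
  ⟨⟨toConv f, toConv g, congrArg toConv h.1, congrArg toConv h.2⟩, rfl, rfl⟩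

/-- Precomposition with a coalgebra map. -/
noncomputable def pull (g : Y →ₗc[k] X) : Reg (k := k) X A →* Reg (k := k) Y A :=
  Units.map
    { toFun := fun f => toConv (f.ofConv ∘ₗ g.toLinearMap)
      map_one' := by
        ext a
        simp
      map_mul' := fun f f' =>
        congrArg toConv (LinearMap.convMul_comp_coalgHom_distrib f f' g) }

lemma lin_pull (g : Y →ₗc[k] X) (u : Reg (k := k) X A) :
    (pull g u).lin = u.lin ∘ₗ g.toLinearMap := rfl

lemma pull_comp (g : Y →ₗc[k] X) (h : C →ₗc[k] Y) (u : Reg (k := k) X A) :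
    pull h (pull g u) = pull (g.comp h) u := rfl

lemma pull_id (u : Reg (k := k) X A) : pull (CoalgHom.id k X) u = u := rfl

variable [Coalgebra.IsCocomm k X] [Coalgebra.IsCocomm k Y]

/-- The product of two `X`-points of a bialgebra. -/
noncomputable def cmul (x y : X →ₗc[k] H) : X →ₗc[k] H :=
  (Bialgebra.mulCoalgHom k H).comp (pair x y)

lemma toConv_cmul (x y : X →ₗc[k] H) :
    toConv (cmul x y).toLinearMap = toConv x.toLinearMap * toConv y.toLinearMap := rfl

lemma cmul_assoc (x y z : X →ₗc[k] H) : cmul (cmul x y) z = cmul x (cmul y z) :=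
  toConv_toLinearMap_injective <| by simp only [toConv_cmul, mul_assoc]

@[simp] lemma cone_cmul (x : X →ₗc[k] H) : cmul cone x = x :=
  toConv_toLinearMap_injective <| by simp only [toConv_cmul, toConv_cone, one_mul]

@[simp] lemma cmul_cone (x : X →ₗc[k] H) : cmul x cone = x :=
  toConv_toLinearMap_injective <| by simp only [toConv_cmul, toConv_cone, mul_one]

lemma cmul_comp (x y : X →ₗc[k] H) (g : Y →ₗc[k] X) :
    (cmul x y).comp g = cmul (x.comp g) (y.comp g) := by
  rw [cmul, CoalgHom.comp_assoc, pair_comp, cmul]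

lemma map_comp_pair {C' D' : Type} [AddCommGroup C'] [Module k C'] [Coalgebra k C']
    [AddCommGroup D'] [Module k D'] [Coalgebra k D'] (f : C →ₗc[k] C') (g : D →ₗc[k] D')
    (x : X →ₗc[k] C) (y : X →ₗc[k] D) :
    (Coalgebra.TensorProduct.map f g).comp (pair x y) = pair (f.comp x) (g.comp y) := by
  refine (pair_eq ?_ ?_).symm
  · rw [← CoalgHom.comp_assoc]
    conv_rhs => rw [← fstC_comp_pair x y, ← CoalgHom.comp_assoc]
    congr 1
    exact coalgHom_ext_tmul fun c d => by simp
  · rw [← CoalgHom.comp_assoc]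
    conv_rhs => rw [← sndC_comp_pair x y, ← CoalgHom.comp_assoc]
    congr 1
    exact coalgHom_ext_tmul fun c d => by simp

lemma bialgHom_comp_cmul (i : N →ₐc[k] H) (x y : X →ₗc[k] N) :
    i.toCoalgHom.comp (cmul x y) = cmul (i.toCoalgHom.comp x) (i.toCoalgHom.comp y) := by
  rw [cmul, cmul, ← map_comp_pair, ← CoalgHom.comp_assoc, ← CoalgHom.comp_assoc]
  congr 1
  exact coalgHom_ext_tmul fun c d => map_mul i c d

variable (k C D E) in
/-- The first projection of a triple tensor product as a coalgebra map. -/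
noncomputable def prj₁ : (C ⊗[k] D) ⊗[k] E →ₗc[k] C := (fstC k C D).comp (fstC k (C ⊗[k] D) E)

variable (k C D E) in
/-- The second projection of a triple tensor product as a coalgebra map. -/
noncomputable def prj₂ : (C ⊗[k] D) ⊗[k] E →ₗc[k] D := (sndC k C D).comp (fstC k (C ⊗[k] D) E)

variable (k C D E) in
/-- The third projection of a triple tensor product as a coalgebra map. -/
noncomputable def prj₃ : (C ⊗[k] D) ⊗[k] E →ₗc[k] E := sndC k (C ⊗[k] D) E

@[simp] lemma prj₁_tmul (c : C) (d : D) (e : E) :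
    prj₁ k C D E ((c ⊗ₜ d) ⊗ₜ e) = (counit (R := k) d * counit (R := k) e) • c := by
  simp [prj₁, mul_smul, smul_comm (counit (R := k) d)]

@[simp] lemma prj₂_tmul (c : C) (d : D) (e : E) :
    prj₂ k C D E ((c ⊗ₜ d) ⊗ₜ e) = (counit (R := k) c * counit (R := k) e) • d := by
  simp [prj₂, mul_smul, smul_comm (counit (R := k) c)]

@[simp] lemma prj₃_tmul (c : C) (d : D) (e : E) :
    prj₃ k C D E ((c ⊗ₜ d) ⊗ₜ e) = (counit (R := k) c * counit (R := k) d) • e := by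
  simp [prj₃, mul_comm]

lemma prj₁_comp_pair (x : X →ₗc[k] C) (y : X →ₗc[k] D) (z : X →ₗc[k] E) :
    (prj₁ k C D E).comp (pair (pair x y) z) = x := by
  rw [prj₁, CoalgHom.comp_assoc, fstC_comp_pair, fstC_comp_pair]

lemma prj₂_comp_pair (x : X →ₗc[k] C) (y : X →ₗc[k] D) (z : X →ₗc[k] E) :
    (prj₂ k C D E).comp (pair (pair x y) z) = y := by
  rw [prj₂, CoalgHom.comp_assoc, fstC_comp_pair, sndC_comp_pair]

lemma prj₃_comp_pair (x : X →ₗc[k] C) (y : X →ₗc[k] D) (z : X →ₗc[k] E) :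
    (prj₃ k C D E).comp (pair (pair x y) z) = z := by
  rw [prj₃, sndC_comp_pair]

/-- The value of a two-variable convolution-invertible map at a pair of `X`-points. -/
noncomputable def ev (u : Reg (k := k) (C ⊗[k] D) A) (x : X →ₗc[k] C) (y : X →ₗc[k] D) :
    Reg (k := k) X A := pull (pair x y) u

lemma pull_ev (g : Y →ₗc[k] X) (u : Reg (k := k) (C ⊗[k] D) A)
    (x : X →ₗc[k] C) (y : X →ₗc[k] D) :
    pull g (ev u x y) = ev u (x.comp g) (y.comp g) := by
  rw [ev, pull_comp, pair_comp, ev]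

lemma ev_mul (u v : Reg (k := k) (C ⊗[k] D) A) (x : X →ₗc[k] C) (y : X →ₗc[k] D) :
    ev (u * v) x y = ev u x y * ev v x y := map_mul _ _ _

lemma ev_div (u v : Reg (k := k) (C ⊗[k] D) A) (x : X →ₗc[k] C) (y : X →ₗc[k] D) :
    ev (u / v) x y = ev u x y / ev v x y := map_div (pull (pair x y)) u v

lemma ev_pull_map {C' D' : Type} [AddCommGroup C'] [Module k C'] [Coalgebra k C']
    [AddCommGroup D'] [Module k D'] [Coalgebra k D'] (f : C →ₗc[k] C') (g : D →ₗc[k] D')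
    (u : Reg (k := k) (C' ⊗[k] D') A) (x : X →ₗc[k] C) (y : X →ₗc[k] D) :
    ev (pull (Coalgebra.TensorProduct.map f g) u) x y = ev u (f.comp x) (g.comp y) := by
  rw [ev, pull_comp, map_comp_pair, ev]

lemma pair_fstC_sndC_eq_id [Coalgebra.IsCocomm k C] [Coalgebra.IsCocomm k D] :
    pair (fstC k _ _) (sndC k _ _) = CoalgHom.id k (C ⊗[k] D) :=
  pair_eq (CoalgHom.comp_id (fstC k _ _)) (CoalgHom.comp_id (sndC k _ _))

lemma ev_fstC_sndC [Coalgebra.IsCocomm k C] [Coalgebra.IsCocomm k D]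
    (u : Reg (k := k) (C ⊗[k] D) A) : ev u (fstC k _ _) (sndC k _ _) = u := by
  rw [ev, pair_fstC_sndC_eq_id, pull_id]

lemma reg_ext_ev [Coalgebra.IsCocomm k C] [Coalgebra.IsCocomm k D]
    {u v : Reg (k := k) (C ⊗[k] D) A}
    (h : ev u (fstC k C D) (sndC k C D) = ev v (fstC k C D) (sndC k C D)) : u = v := by
  rwa [ev_fstC_sndC, ev_fstC_sndC] at h

section Triple

variable [Coalgebra.IsCocomm k C] [Coalgebra.IsCocomm k D] [Coalgebra.IsCocomm k E]

lemma pair_prj₁_prj₂ : pair (prj₁ k C D E) (prj₂ k C D E) = fstC k (C ⊗[k] D) E :=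
  pair_eq rfl rfl

lemma pair_prj₂_prj₃ : pair (prj₂ k C D E) (prj₃ k C D E) =
    (sndC k C (D ⊗[k] E)).comp (Coalgebra.TensorProduct.assoc k k C D E).toCoalgHom := by
  refine pair_eq ?_ ?_
  · exact coalgHom_ext_tmul₃ fun c d e => by simp [mul_smul]
  · exact coalgHom_ext_tmul₃ fun c d e => by simp [mul_smul]

end Triple

end Products

end SmashPaper

namespace SmashPaper

section Translation

open Coalgebra WithConv

variable {k : Type} [Field k]

section

variable {X C : Type} [AddCommGroup X] [Module k X] [Coalgebra k X]
  [AddCommGroup C] [Module k C] [Coalgebra k C]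
variable {H : Type} [Ring H] [Bialgebra k H]

lemma pair_cone_left_apply [Coalgebra.IsCocomm k X] (y : X →ₗc[k] C) (a : X) :
    pair (cone : X →ₗc[k] H) y a = 1 ⊗ₜ y a := by
  have h : pair (cone : X →ₗc[k] H) y a =
      TensorProduct.map (Algebra.linearMap k H) y.toLinearMap
        (LinearMap.rTensor X counit (comul (R := k) a)) := by
    rw [pair_apply, LinearMap.rTensor, TensorProduct.map_map]
    rfl
  rw [h]
  simp

lemma pair_cone_right_apply [Coalgebra.IsCocomm k X] (x : X →ₗc[k] C) (a : X) :
    pair x (cone : X →ₗc[k] H) a = x a ⊗ₜ 1 := by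
  have h : pair x (cone : X →ₗc[k] H) a =
      TensorProduct.map x.toLinearMap (Algebra.linearMap k H)
        (LinearMap.lTensor X counit (comul (R := k) a)) := by
    rw [pair_apply, LinearMap.lTensor, TensorProduct.map_map]
    rfl
  rw [h]
  simp

variable {A : Type} [CommRing A] [Algebra k A]

lemma lin_ev_cone_left [Coalgebra.IsCocomm k C] (u : Reg (k := k) (H ⊗[k] C) A) (a : C) :
    (ev u cone (CoalgHom.id k C)).lin a = u.lin (1 ⊗ₜ a) :=
  congrArg u.lin (pair_cone_left_apply (CoalgHom.id k C) a)

lemma lin_ev_cone_right [Coalgebra.IsCocomm k C] (u : Reg (k := k) (C ⊗[k] H) A) (a : C) :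
    (ev u (CoalgHom.id k C) cone).lin a = u.lin (a ⊗ₜ 1) :=
  congrArg u.lin (pair_cone_right_apply (CoalgHom.id k C) a)

end

section Sweedler

variable {H A : Type} [Ring H] [Bialgebra k H] [CommRing A] [Algebra k A]

lemma reg_eq_one_iff {X : Type} [AddCommGroup X] [Module k X] [Coalgebra k X]
    (u : Reg (k := k) X A) : u = 1 ↔ ∀ a, u.lin a = algebraMap k A (counit a) :=
  ⟨fun h a => by rw [h]; rfl, fun h => Reg.lin_injective (LinearMap.ext h)⟩

lemma pull_cone (t : Reg (k := k) H A) (ht : Normalized1 t.lin)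
    {X : Type} [AddCommGroup X] [Module k X] [Coalgebra k X] :
    pull (cone : X →ₗc[k] H) t = 1 := by
  rw [reg_eq_one_iff]
  intro a
  have h : (pull (cone : X →ₗc[k] H) t).lin a = t.lin (algebraMap k H (counit a)) := rfl
  rw [h, Algebra.algebraMap_eq_smul_one, map_smul, ht, Algebra.algebraMap_eq_smul_one]

variable [Coalgebra.IsCocomm k H]

/-- The 2-cocycle conditions, expressed on points. -/
structure PtZ2 (u : Reg (k := k) (H ⊗[k] H) A) : Prop where
  one_left : ∀ (X : Type) [AddCommGroup X] [Module k X] [Coalgebra k X]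
    [Coalgebra.IsCocomm k X] (x : X →ₗc[k] H), ev u cone x = 1
  one_right : ∀ (X : Type) [AddCommGroup X] [Module k X] [Coalgebra k X]
    [Coalgebra.IsCocomm k X] (x : X →ₗc[k] H), ev u x cone = 1
  cocycle : ∀ (X : Type) [AddCommGroup X] [Module k X] [Coalgebra k X]
    [Coalgebra.IsCocomm k X] (x y z : X →ₗc[k] H),
    ev u x y * ev u (cmul x y) z = ev u y z * ev u x (cmul y z)

lemma normalized2_iff (u : Reg (k := k) (H ⊗[k] H) A) :
    Normalized2 u.lin ↔
      ev u cone (CoalgHom.id k H) = 1 ∧ ev u (CoalgHom.id k H) cone = 1 := by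
  simp only [Normalized2, forall_and, reg_eq_one_iff, lin_ev_cone_left,
    lin_ev_cone_right]

lemma cocycle2LHS_eq (u : Reg (k := k) (H ⊗[k] H) A) :
    cocycle2LHS u.lin = (ev u (prj₁ k H H H) (prj₂ k H H H) *
      ev u (cmul (prj₁ k H H H) (prj₂ k H H H))
        (prj₃ k H H H)).lin := by
  have h₂ : pair (cmul (prj₁ k H H H) (prj₂ k H H H))
      (prj₃ k H H H)
      = Coalgebra.TensorProduct.map (Bialgebra.mulCoalgHom k H) (CoalgHom.id k H) := by
    refine pair_eq ?_ ?_
    · rw [cmul, pair_prj₁_prj₂]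
      exact coalgHom_ext_tmul₃ fun c d e => by simp
    · exact coalgHom_ext_tmul₃ fun c d e => by simp
  rw [Reg.lin_mul, ev, ev, pair_prj₁_prj₂, h₂]
  rfl

lemma cocycle2RHS_eq (u : Reg (k := k) (H ⊗[k] H) A) :
    cocycle2RHS u.lin = (ev u (prj₂ k H H H) (prj₃ k H H H) *
      ev u (prj₁ k H H H) (cmul (prj₂ k H H H) (prj₃ k H H H))).lin := by
  have h₂ : pair (prj₁ k H H H) (cmul (prj₂ k H H H)
      (prj₃ k H H H))
      = (Coalgebra.TensorProduct.map (CoalgHom.id k H) (Bialgebra.mulCoalgHom k H)).comp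
          (Coalgebra.TensorProduct.assoc k k H H H).toCoalgHom := by
    refine pair_eq ?_ ?_
    · exact coalgHom_ext_tmul₃ fun c d e => by simp [mul_smul]
    · rw [cmul, pair_prj₂_prj₃]
      exact coalgHom_ext_tmul₃ fun c d e => by simp
  rw [Reg.lin_mul, ev, ev, pair_prj₂_prj₃, h₂]
  rfl

lemma isZ2_iff (u : Reg (k := k) (H ⊗[k] H) A) : IsZ2 u.lin ↔ PtZ2 u := by
  rw [IsZ2, normalized2_iff, cocycle2LHS_eq, cocycle2RHS_eq]
  constructor
  · rintro ⟨⟨h₁, h₂⟩, -, h₃⟩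
    refine ⟨fun X _ _ _ _ x => ?_, fun X _ _ _ _ x => ?_, fun X _ _ _ _ x y z => ?_⟩
    · simpa [pull_ev, CoalgHom.id_comp] using congrArg (pull x) h₁
    · simpa [pull_ev, CoalgHom.id_comp] using congrArg (pull x) h₂
    · have h := congrArg (pull (pair (pair x y) z)) (Reg.lin_injective h₃)
      simpa only [map_mul, pull_ev, cmul_comp, prj₁_comp_pair, prj₂_comp_pair,
        prj₃_comp_pair] using h
  · intro h
    exact ⟨⟨h.one_left H _, h.one_right H _⟩, ⟨_, u.isConvInv⟩,
      congrArg Reg.lin (h.cocycle _ _ _ _)⟩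

/-- The coboundary of `t`, as a convolution-invertible map. -/
noncomputable def cob (t : Reg (k := k) H A) : Reg (k := k) (H ⊗[k] H) A :=
  pull (sndC k H H) t * ((pull (cmul (fstC k H H) (sndC k H H)) t)⁻¹ * pull (fstC k H H) t)

lemma ev_cob (t : Reg (k := k) H A) {X : Type} [AddCommGroup X] [Module k X] [Coalgebra k X]
    [Coalgebra.IsCocomm k X] (x y : X →ₗc[k] H) :
    ev (cob t) x y = pull y t * ((pull (cmul x y) t)⁻¹ * pull x t) := by
  rw [ev, cob]
  simp only [map_mul, map_inv, pull_comp, cmul_comp, fstC_comp_pair, sndC_comp_pair]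

lemma lin_cob (t : Reg (k := k) H A) : (cob t).lin = cobound2 t.lin t⁻¹.lin := by
  rw [cob, Reg.lin_mul, Reg.lin_mul, ← map_inv, lin_pull, lin_pull, lin_pull, cmul,
    pair_fstC_sndC_eq_id]
  rfl

lemma isB2_iff (b : H ⊗[k] H →ₗ[k] A) :
    IsB2 b ↔ ∃ t : Reg (k := k) H A, Normalized1 t.lin ∧ b = (cob t).lin := by
  constructor
  · rintro ⟨t, t', hn, hi, h⟩
    obtain ⟨t, rfl, rfl⟩ := exists_reg_of_isConvInv hi
    exact ⟨t, hn, h.trans (lin_cob t).symm⟩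
  · rintro ⟨t, hn, h⟩
    exact ⟨_, _, hn, t.isConvInv, h.trans (lin_cob t)⟩

end Sweedler

end Translation

end SmashPaper

namespace SmashPaper

section MeasuringPoints

open Coalgebra WithConv

variable {k : Type} [Field k]
variable {T N A : Type} [Ring T] [Bialgebra k T] [Ring N] [Bialgebra k N]
  [CommRing A] [Algebra k A]

/-- The action on points. -/
noncomputable def act (m : T ⊗[k] N →ₗc[k] N) {X : Type} [AddCommGroup X] [Module k X]
    [Coalgebra k X] [Coalgebra.IsCocomm k X] (t : X →ₗc[k] T) (n : X →ₗc[k] N) : X →ₗc[k] N :=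
  m.comp (pair t n)

lemma act_comp (m : T ⊗[k] N →ₗc[k] N) {X Y : Type} [AddCommGroup X] [Module k X]
    [Coalgebra k X] [Coalgebra.IsCocomm k X] [AddCommGroup Y] [Module k Y]
    [Coalgebra k Y] [Coalgebra.IsCocomm k Y] (t : X →ₗc[k] T) (n : X →ₗc[k] N)
    (g : Y →ₗc[k] X) : (act m t n).comp g = act m (t.comp g) (n.comp g) := by
  rw [act, act, CoalgHom.comp_assoc, pair_comp]

lemma lin_pull_mul_pull_tmul [Coalgebra.IsCocomm k N] (g h : Reg (k := k) N A) (a b : N) :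
    (pull (fstC k N N) g * pull (sndC k N N) h).lin (a ⊗ₜ b) = g.lin a * h.lin b := by
  have e : (pull (fstC k N N) g * pull (sndC k N N) h).lin (a ⊗ₜ b)
      = LinearMap.mul' k A (TensorProduct.map g.lin h.lin
          (TensorProduct.map (fstC k N N).toLinearMap (sndC k N N).toLinearMap
            (comul (R := k) (a ⊗ₜ[k] b)))) := by
    rw [TensorProduct.map_map]
    rfl
  rw [e, map_fstC_sndC_comul]
  simp

variable [Coalgebra.IsCocomm k T] [Coalgebra.IsCocomm k N]

/-- The measuring 1-cocycle conditions, expressed on points. -/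
structure PtMeasZ1 (m : T ⊗[k] N →ₗc[k] N) (u : Reg (k := k) (T ⊗[k] N) A) : Prop where
  mul_right : ∀ (X : Type) [AddCommGroup X] [Module k X] [Coalgebra k X]
    [Coalgebra.IsCocomm k X] (t : X →ₗc[k] T) (n n' : X →ₗc[k] N),
    ev u t (cmul n n') = ev u t n * ev u t n'
  one_right : ∀ (X : Type) [AddCommGroup X] [Module k X] [Coalgebra k X]
    [Coalgebra.IsCocomm k X] (t : X →ₗc[k] T), ev u t cone = 1
  one_left : ∀ (X : Type) [AddCommGroup X] [Module k X] [Coalgebra k X]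
    [Coalgebra.IsCocomm k X] (n : X →ₗc[k] N), ev u cone n = 1
  cocycle : ∀ (X : Type) [AddCommGroup X] [Module k X] [Coalgebra k X]
    [Coalgebra.IsCocomm k X] (t s : X →ₗc[k] T) (n : X →ₗc[k] N),
    ev u (cmul t s) n = ev u s n * ev u t (act m s n)

lemma measures_iff (u : Reg (k := k) (T ⊗[k] N) A) :
    Measures u.lin ↔
      (ev u (fstC k T (N ⊗[k] N))
        (cmul ((fstC k N N).comp (sndC k T (N ⊗[k] N)))
          ((sndC k N N).comp (sndC k T (N ⊗[k] N))))
        = ev u (fstC k T (N ⊗[k] N)) ((fstC k N N).comp (sndC k T (N ⊗[k] N)))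
          * ev u (fstC k T (N ⊗[k] N)) ((sndC k N N).comp (sndC k T (N ⊗[k] N))))
      ∧ ev u (CoalgHom.id k T) cone = 1 := by
  have h₀ : pair ((fstC k N N).comp (sndC k T (N ⊗[k] N)))
      ((sndC k N N).comp (sndC k T (N ⊗[k] N))) = sndC k T (N ⊗[k] N) := pair_eq rfl rfl
  have key (D : Type) [AddCommGroup D] [Module k D] [Coalgebra k D] (g : N ⊗[k] N →ₗc[k] D) :
      pair (fstC k T (N ⊗[k] N)) (g.comp (sndC k T (N ⊗[k] N)))
        = Coalgebra.TensorProduct.map (CoalgHom.id k T) g := by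
    have h := map_comp_pair (CoalgHom.id k T) g (fstC k T (N ⊗[k] N)) (sndC k T (N ⊗[k] N))
    rw [pair_fstC_sndC_eq_id, CoalgHom.comp_id, CoalgHom.id_comp] at h
    exact h.symm
  rw [Measures, reg_eq_one_iff]
  simp only [lin_ev_cone_right]
  refine and_congr_left fun _ => ?_
  rw [cmul, h₀, ev, ev, ev, key, key, key]
  exact ⟨fun h => Reg.lin_injective h, fun h => congrArg Reg.lin h⟩

lemma measCocycle1_iff (m : T ⊗[k] N →ₗc[k] N) (u : Reg (k := k) (T ⊗[k] N) A) :
    MeasCocycle1 m.toLinearMap u.lin ↔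
      ev u (cmul (prj₁ k T T N) (prj₂ k T T N)) (prj₃ k T T N)
        = ev u (prj₂ k T T N) (prj₃ k T T N)
          * ev u (prj₁ k T T N) (act m (prj₂ k T T N) (prj₃ k T T N)) := by
  have h₁ : pair (cmul (prj₁ k T T N) (prj₂ k T T N)) (prj₃ k T T N)
      = Coalgebra.TensorProduct.map (Bialgebra.mulCoalgHom k T) (CoalgHom.id k N) := by
    refine pair_eq ?_ ?_
    · rw [cmul, pair_prj₁_prj₂]
      exact coalgHom_ext_tmul₃ fun c d e => by simp
    · exact coalgHom_ext_tmul₃ fun c d e => by simp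
  have h₂ : pair (prj₂ k T T N) (prj₃ k T T N)
      = Coalgebra.TensorProduct.map (sndC k T T) (CoalgHom.id k N) := by
    refine pair_eq ?_ ?_
    · exact coalgHom_ext_tmul₃ fun c d e => by simp [mul_smul, smul_comm (counit (R := k) c)]
    · exact coalgHom_ext_tmul₃ fun c d e => by simp [mul_smul]
  have h₃ : pair (prj₁ k T T N) (act m (prj₂ k T T N) (prj₃ k T T N))
      = (Coalgebra.TensorProduct.map (CoalgHom.id k T) m).comp
          (Coalgebra.TensorProduct.assoc k k T T N).toCoalgHom := by
    refine pair_eq ?_ ?_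
    · exact coalgHom_ext_tmul₃ fun c d e => by
        simp [mul_smul, smul_comm (counit (R := k) e)]
    · rw [act, pair_prj₂_prj₃]
      exact coalgHom_ext_tmul₃ fun c d e => by simp
  rw [ev, ev, ev, h₁, h₂, h₃]
  exact ⟨fun h => Reg.lin_injective h, fun h => congrArg Reg.lin h⟩

lemma isMeasZ1_iff (m : T ⊗[k] N →ₗc[k] N) (u : Reg (k := k) (T ⊗[k] N) A) :
    IsMeasZ1 m.toLinearMap u.lin ↔ PtMeasZ1 m u := by
  have h₀ : MeasNormalized1 u.lin ↔ ev u cone (CoalgHom.id k N) = 1 := by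
    simp only [MeasNormalized1, reg_eq_one_iff, lin_ev_cone_left]
  rw [IsMeasZ1, IsRegMeas1, measures_iff, measCocycle1_iff, h₀]
  constructor
  · rintro ⟨⟨⟨h₁, h₂⟩, h₃, -⟩, h₄⟩
    refine ⟨fun X _ _ _ _ t n n' => ?_, fun X _ _ _ _ x => ?_, fun X _ _ _ _ x => ?_,
      fun X _ _ _ _ t s n => ?_⟩
    · have h := congrArg (pull (pair t (pair n n'))) h₁
      simpa only [map_mul, pull_ev, cmul_comp, CoalgHom.comp_assoc, fstC_comp_pair,
        sndC_comp_pair] using h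
    · simpa [pull_ev, CoalgHom.id_comp] using congrArg (pull x) h₂
    · simpa [pull_ev, CoalgHom.id_comp] using congrArg (pull x) h₃
    · have h := congrArg (pull (pair (pair t s) n)) h₄
      simpa only [map_mul, pull_ev, cmul_comp, act_comp, prj₁_comp_pair, prj₂_comp_pair,
        prj₃_comp_pair] using h
  · intro h
    exact ⟨⟨⟨h.mul_right _ _ _ _, h.one_right _ _⟩, h.one_left _ _, _, u.isConvInv⟩,
      h.cocycle _ _ _ _⟩

lemma isMeasB1_of_ev (m : T ⊗[k] N →ₗc[k] N) (u : Reg (k := k) (T ⊗[k] N) A)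
    (g : Reg (k := k) N A) (hn : Normalized1 g.lin)
    (hg : pull (cmul (fstC k N N) (sndC k N N)) g = pull (fstC k N N) g * pull (sndC k N N) g)
    (h : ev u (fstC k T N) (sndC k T N)
      = pull (sndC k T N) g * (pull (act m (fstC k T N) (sndC k T N)) g)⁻¹) :
    IsMeasB1 m.toLinearMap u.lin := by
  refine ⟨AlgHom.ofLinearMap g.lin hn fun a b => ?_, g⁻¹.lin, g.isConvInv, ?_⟩
  · rw [← lin_pull_mul_pull_tmul, ← hg, cmul, pair_fstC_sndC_eq_id]
    rfl
  · rw [ev_fstC_sndC, act, pair_fstC_sndC_eq_id, ← map_inv] at h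
    exact congrArg Reg.lin h

end MeasuringPoints

end SmashPaper

namespace SmashPaper

section Smash

open Coalgebra WithConv

variable {k : Type} [Field k]
variable {T N H : Type} [Ring T] [Bialgebra k T] [Ring N] [Bialgebra k N]
  [Ring H] [Bialgebra k H]

lemma isCocomm_of_surjective {C D : Type} [AddCommGroup C] [Module k C] [Coalgebra k C]
    [AddCommGroup D] [Module k D] [Coalgebra k D] [Coalgebra.IsCocomm k C] (φ : C →ₗc[k] D)
    (hφ : Function.Surjective φ) : Coalgebra.IsCocomm k D where
  comm_comp_comul := by
    ext d
    obtain ⟨c, rfl⟩ := hφ d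
    rw [LinearMap.comp_apply, ← CoalgHomClass.map_comp_comul_apply, LinearEquiv.coe_coe,
      ← TensorProduct.map_comm]
    congr 1
    exact LinearMap.congr_fun (Coalgebra.IsCocomm.comm_comp_comul (R := k) (A := C)) c

lemma exists_coalgHom_of_isModuleBialgebra {μ : T ⊗[k] N →ₗ[k] N} (h : IsModuleBialgebra μ) :
    ∃ m : T ⊗[k] N →ₗc[k] N, m.toLinearMap = μ := by
  refine ⟨⟨μ, ?_, ?_⟩, rfl⟩
  · exact TensorProduct.ext' fun t n => (h.counit_act t n).trans (by simp [mul_comm])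
  · rw [h.comul_act]
    rfl

/-- `H` is a smash product, expressed on points. -/
structure PtSmash (m : T ⊗[k] N →ₗc[k] N) (iN : N →ₐc[k] H) (iT : T →ₐc[k] H)
    (pN : H →ₗc[k] N) (pT : H →ₗc[k] T) : Prop where
  split : ∀ (X : Type) [AddCommGroup X] [Module k X] [Coalgebra k X]
    [Coalgebra.IsCocomm k X] (x : X →ₗc[k] H),
    cmul (iN.toCoalgHom.comp (pN.comp x)) (iT.toCoalgHom.comp (pT.comp x)) = x
  fst_cmul : ∀ (X : Type) [AddCommGroup X] [Module k X] [Coalgebra k X]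
    [Coalgebra.IsCocomm k X] (n : X →ₗc[k] N) (t : X →ₗc[k] T),
    pN.comp (cmul (iN.toCoalgHom.comp n) (iT.toCoalgHom.comp t)) = n
  snd_cmul : ∀ (X : Type) [AddCommGroup X] [Module k X] [Coalgebra k X]
    [Coalgebra.IsCocomm k X] (n : X →ₗc[k] N) (t : X →ₗc[k] T),
    pT.comp (cmul (iN.toCoalgHom.comp n) (iT.toCoalgHom.comp t)) = t
  straighten : ∀ (X : Type) [AddCommGroup X] [Module k X] [Coalgebra k X]
    [Coalgebra.IsCocomm k X] (n : X →ₗc[k] N) (t : X →ₗc[k] T),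
    cmul (iT.toCoalgHom.comp t) (iN.toCoalgHom.comp n)
      = cmul (iN.toCoalgHom.comp (act m t n)) (iT.toCoalgHom.comp t)

lemma smashCross_eq [Coalgebra.IsCocomm k T] [Coalgebra.IsCocomm k N]
    (m : T ⊗[k] N →ₗc[k] N) :
    smashCross m.toLinearMap = (pair m (fstC k T N)).toLinearMap := by
  refine TensorProduct.ext' fun t n => ?_
  have key : ∀ (p : T ⊗[k] T) (q : N ⊗[k] N),
      TensorProduct.map m.toLinearMap LinearMap.id ((TensorProduct.assoc k T N T).symm
        (LinearMap.lTensor T (TensorProduct.comm k T N).toLinearMap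
          (TensorProduct.assoc k T T N (p ⊗ₜ dropR N N q))))
      = TensorProduct.map m.toLinearMap (fstC k T N).toLinearMap
          (TensorProduct.tensorTensorTensorComm k T T N N (p ⊗ₜ q)) := by
    intro p q
    induction p with
    | zero => simp
    | add x y hx hy => simp only [TensorProduct.add_tmul, map_add, hx, hy]
    | tmul a b =>
      induction q with
      | zero => simp
      | add x y hx hy => simp only [TensorProduct.tmul_add, map_add, hx, hy]
      | tmul c d =>
        simp [dropR]
  have h := key (comul t) (comul n)
  rw [dropR_comul] at h
  exact h

lemma exists_ptSmash [Coalgebra.IsCocomm k T] [Coalgebra.IsCocomm k N]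
    (m : T ⊗[k] N →ₗc[k] N) (iN : N →ₐc[k] H) (iT : T →ₐc[k] H)
    (h : IsSmashProduct m.toLinearMap iN iT) :
    Coalgebra.IsCocomm k H ∧
      ∃ (pN : H →ₗc[k] N) (pT : H →ₗc[k] T), PtSmash m iN iT pN pT := by
  obtain ⟨φ, hd⟩ : ∃ φ : N ⊗[k] T →ₗc[k] H, φ = (Bialgebra.mulCoalgHom k H).comp
    (Coalgebra.TensorProduct.map iN.toCoalgHom iT.toCoalgHom) := ⟨_, rfl⟩
  have hφ : Function.Bijective φ := by
    rw [hd]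
    exact h.bij
  obtain ⟨ψ, e₁, e₂⟩ : ∃ ψ : H →ₗc[k] N ⊗[k] T,
      φ.comp ψ = CoalgHom.id k H ∧ ψ.comp φ = CoalgHom.id k (N ⊗[k] T) := by
    let e : N ⊗[k] T ≃ₗc[k] H := CoalgEquiv.ofBijective (f := φ) hφ
    refine ⟨e.symm.toCoalgHom, ?_, coalgHom_ext_tmul fun a b => ?_⟩
    · ext x
      exact e.apply_symm_apply x
    · exact e.symm_apply_apply (a ⊗ₜ b)
  have hc (X : Type) [AddCommGroup X] [Module k X] [Coalgebra k X]
      [Coalgebra.IsCocomm k X] (n : X →ₗc[k] N) (t : X →ₗc[k] T) :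
      cmul (iN.toCoalgHom.comp n) (iT.toCoalgHom.comp t) = φ.comp (pair n t) := by
    rw [cmul, ← map_comp_pair, ← CoalgHom.comp_assoc, ← hd]
  refine ⟨isCocomm_of_surjective φ hφ.2, (fstC k N T).comp ψ,
    (sndC k N T).comp ψ, ?_, ?_, ?_, ?_⟩
  · intro X _ _ _ _ x
    rw [hc, CoalgHom.comp_assoc, CoalgHom.comp_assoc, pair_fstC_sndC, ← CoalgHom.comp_assoc, e₁,
      CoalgHom.id_comp]
  · intro X _ _ _ _ n t
    rw [hc, CoalgHom.comp_assoc, ← CoalgHom.comp_assoc ψ, e₂, CoalgHom.id_comp, fstC_comp_pair]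
  · intro X _ _ _ _ n t
    rw [hc, CoalgHom.comp_assoc, ← CoalgHom.comp_assoc ψ, e₂, CoalgHom.id_comp, sndC_comp_pair]
  · intro X _ _ _ _ n t
    have hs : (Bialgebra.mulCoalgHom k H).comp
        (Coalgebra.TensorProduct.map iT.toCoalgHom iN.toCoalgHom)
        = φ.comp (pair m (fstC k T N)) := by
      apply CoalgHom.coe_linearMap_injective
      have h' := h.straighten
      rw [smashCross_eq] at h'
      rw [hd]
      exact h'
    rw [hc, cmul, ← map_comp_pair, ← CoalgHom.comp_assoc, hs, CoalgHom.comp_assoc, pair_comp,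
      fstC_comp_pair, act]

variable {m : T ⊗[k] N →ₗc[k] N} {iN : N →ₐc[k] H} {iT : T →ₐc[k] H}
  {pN : H →ₗc[k] N} {pT : H →ₗc[k] T}

namespace PtSmash

variable {X : Type} [AddCommGroup X] [Module k X] [Coalgebra k X] [Coalgebra.IsCocomm k X]

lemma fst_inclN (h : PtSmash m iN iT pN pT) (n : X →ₗc[k] N) :
    pN.comp (iN.toCoalgHom.comp n) = n := by
  simpa using h.fst_cmul X n cone

lemma snd_inclN (h : PtSmash m iN iT pN pT) (n : X →ₗc[k] N) :
    pT.comp (iN.toCoalgHom.comp n) = cone := by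
  simpa using h.snd_cmul X n cone

lemma fst_inclT (h : PtSmash m iN iT pN pT) (t : X →ₗc[k] T) :
    pN.comp (iT.toCoalgHom.comp t) = cone := by
  simpa using h.fst_cmul X cone t

lemma snd_inclT (h : PtSmash m iN iT pN pT) (t : X →ₗc[k] T) :
    pT.comp (iT.toCoalgHom.comp t) = t := by
  simpa using h.snd_cmul X cone t

lemma fst_cone (h : PtSmash m iN iT pN pT) : pN.comp (cone : X →ₗc[k] H) = cone := by
  simpa using h.fst_inclN (cone : X →ₗc[k] N)

lemma snd_cone (h : PtSmash m iN iT pN pT) : pT.comp (cone : X →ₗc[k] H) = cone := by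
  simpa using h.snd_inclN (cone : X →ₗc[k] N)

lemma cmul_eq (h : PtSmash m iN iT pN pT) (x y : X →ₗc[k] H) :
    cmul x y = cmul (iN.toCoalgHom.comp (cmul (pN.comp x) (act m (pT.comp x) (pN.comp y))))
      (iT.toCoalgHom.comp (cmul (pT.comp x) (pT.comp y))) := by
  conv_lhs => rw [← h.split X x, ← h.split X y]
  rw [cmul_assoc, ← cmul_assoc (iT.toCoalgHom.comp _), h.straighten, bialgHom_comp_cmul,
    bialgHom_comp_cmul, cmul_assoc, cmul_assoc]

lemma fst_comp_cmul (h : PtSmash m iN iT pN pT) (x y : X →ₗc[k] H) :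
    pN.comp (cmul x y) = cmul (pN.comp x) (act m (pT.comp x) (pN.comp y)) := by
  rw [h.cmul_eq, h.fst_cmul]

lemma snd_comp_cmul (h : PtSmash m iN iT pN pT) (x y : X →ₗc[k] H) :
    pT.comp (cmul x y) = cmul (pT.comp x) (pT.comp y) := by
  rw [h.cmul_eq, h.snd_cmul]

end PtSmash

end Smash

end SmashPaper

namespace SmashPaper

section Iota

open Coalgebra WithConv

variable {k : Type} [Field k]

section Cocycles

variable {H A : Type} [Ring H] [Bialgebra k H] [CommRing A] [Algebra k A]

lemma PtZ2.div {u v : Reg (k := k) (H ⊗[k] H) A} (hu : PtZ2 u) (hv : PtZ2 v) :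
    PtZ2 (u / v) where
  one_left X _ _ _ _ x := by rw [ev_div, hu.one_left, hv.one_left, div_one]
  one_right X _ _ _ _ x := by rw [ev_div, hu.one_right, hv.one_right, div_one]
  cocycle X _ _ _ _ x y z := by
    simp only [ev_div, div_mul_div_comm, hu.cocycle, hv.cocycle]

lemma cob_cocycle_identity {G : Type} [CommGroup G] (x y z xy yz xyz : G) :
    y * (xy⁻¹ * x) * (z * (xyz⁻¹ * xy)) = z * (yz⁻¹ * y) * (yz * (xyz⁻¹ * x)) := by
  apply Additive.ofMul.injective
  simp only [ofMul_mul, ofMul_inv]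
  abel

lemma eq_mul_of_cob_eq_one {G : Type} [CommGroup G] {x y xy : G} (h : y * (xy⁻¹ * x) = 1) :
    xy = x * y := by
  rw [mul_left_comm, inv_mul_eq_one] at h
  rw [h, mul_comm]

lemma ptZ2_cob [Coalgebra.IsCocomm k H] (t : Reg (k := k) H A) (ht : Normalized1 t.lin) : PtZ2 (cob t) where
  one_left X _ _ _ _ x := by simp [ev_cob, pull_cone t ht]
  one_right X _ _ _ _ x := by simp [ev_cob, pull_cone t ht]
  cocycle X _ _ _ _ x y z := by
    simp only [ev_cob, cmul_assoc]
    exact cob_cocycle_identity _ _ _ _ _ _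

end Cocycles

variable {T N H A : Type} [Ring T] [Bialgebra k T] [Ring N] [Bialgebra k N]
  [Ring H] [Bialgebra k H] [CommRing A] [Algebra k A]
variable {m : T ⊗[k] N →ₗc[k] N} {iN : N →ₐc[k] H} {iT : T →ₐc[k] H}
  {pN : H →ₗc[k] N} {pT : H →ₗc[k] T}

section Elements

variable [Coalgebra.IsCocomm k T] [Coalgebra.IsCocomm k N]

lemma cmul_incl_tmul (n : N) (t : T) :
    cmul (iN.toCoalgHom.comp (fstC k N T)) (iT.toCoalgHom.comp (sndC k N T)) (n ⊗ₜ t)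
      = iN n * iT t := by
  rw [cmul, ← map_comp_pair, pair_fstC_sndC_eq_id]
  rfl

lemma PtSmash.fst_mul (h : PtSmash m iN iT pN pT) (n : N) (t : T) :
    pN (iN n * iT t) = counit (R := k) t • n := by
  have e := DFunLike.congr_fun (h.fst_cmul _ (fstC k N T) (sndC k N T)) (n ⊗ₜ t)
  rwa [CoalgHom.comp_apply, cmul_incl_tmul, fstC_tmul] at e

lemma PtSmash.snd_mul (h : PtSmash m iN iT pN pT) (n : N) (t : T) :
    pT (iN n * iT t) = counit (R := k) n • t := by
  have e := DFunLike.congr_fun (h.snd_cmul _ (fstC k N T) (sndC k N T)) (n ⊗ₜ t)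
  rwa [CoalgHom.comp_apply, cmul_incl_tmul, sndC_tmul] at e

lemma PtSmash.iotaOf_iff (h : PtSmash m iN iT pN pT) (hs : IsSmashProduct m.toLinearMap iN iT)
    (f : T ⊗[k] N →ₗ[k] A) (F : H ⊗[k] H →ₗ[k] A) :
    IotaOf iN iT f F ↔ F = f ∘ₗ (Coalgebra.TensorProduct.map pT pN).toLinearMap := by
  have key (n : N) (t : T) (n' : N) (t' : T) :
      (f ∘ₗ (Coalgebra.TensorProduct.map pT pN).toLinearMap)
        ((iN n * iT t) ⊗ₜ[k] (iN n' * iT t'))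
        = algebraMap k A (counit n * counit t') * f (t ⊗ₜ[k] n') := by
    have e : (f ∘ₗ (Coalgebra.TensorProduct.map pT pN).toLinearMap)
        ((iN n * iT t) ⊗ₜ[k] (iN n' * iT t'))
        = f (pT (iN n * iT t) ⊗ₜ pN (iN n' * iT t')) := rfl
    rw [e, h.fst_mul, h.snd_mul, TensorProduct.smul_tmul_smul, map_smul, Algebra.smul_def]
  constructor
  · intro hF
    rw [← LinearMap.cancel_right (TensorProduct.map_surjective hs.bij.2 hs.bij.2)]
    refine TensorProduct.ext_fourfold' fun n t n' t' => ?_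
    exact (hF n t n' t').trans (key n t n' t').symm
  · rintro rfl
    exact key

end Elements

lemma PtSmash.ptZ2 (h : PtSmash m iN iT pN pT) {u : Reg (k := k) (T ⊗[k] N) A}
    (hu : PtMeasZ1 m u) : PtZ2 (pull (Coalgebra.TensorProduct.map pT pN) u) where
  one_left X _ _ _ _ x := by rw [ev_pull_map, h.snd_cone, hu.one_left]
  one_right X _ _ _ _ x := by rw [ev_pull_map, h.fst_cone, hu.one_right]
  cocycle X _ _ _ _ x y z := by
    simp only [ev_pull_map]
    rw [h.snd_comp_cmul, h.fst_comp_cmul, hu.cocycle, hu.mul_right, mul_left_comm]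

lemma PtSmash.res_inclT [Coalgebra.IsCocomm k T] (h : PtSmash m iN iT pN pT) {u : Reg (k := k) (T ⊗[k] N) A}
    (hu : PtMeasZ1 m u) :
    pull (Coalgebra.TensorProduct.map iT.toCoalgHom iT.toCoalgHom)
      (pull (Coalgebra.TensorProduct.map pT pN) u) = cob 1 := by
  apply reg_ext_ev
  rw [ev_pull_map, ev_pull_map, h.fst_inclT, hu.one_right, ev_cob]
  simp

lemma PtSmash.isMeasB1 [Coalgebra.IsCocomm k T] [Coalgebra.IsCocomm k N]
    [Coalgebra.IsCocomm k H] (h : PtSmash m iN iT pN pT) {u : Reg (k := k) (T ⊗[k] N) A}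
    (hu : PtMeasZ1 m u) (t : Reg (k := k) H A) (ht : Normalized1 t.lin)
    (hF : pull (Coalgebra.TensorProduct.map pT pN) u = cob t) :
    IsMeasB1 m.toLinearMap u.lin := by
  have key (X : Type) [AddCommGroup X] [Module k X] [Coalgebra k X] [Coalgebra.IsCocomm k X]
      (x y : X →ₗc[k] H) : ev u (pT.comp x) (pN.comp y)
        = pull y t * ((pull (cmul x y) t)⁻¹ * pull x t) := by
    rw [← ev_pull_map, hF, ev_cob]
  refine isMeasB1_of_ev m u (pull iN.toCoalgHom t) ?_ ?_ ?_
  · exact (congrArg t.lin (map_one iN)).trans ht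
  · have e := key _ (iN.toCoalgHom.comp (fstC k N N)) (iN.toCoalgHom.comp (sndC k N N))
    rw [h.snd_inclN, hu.one_left, ← bialgHom_comp_cmul] at e
    simp only [pull_comp]
    exact eq_mul_of_cob_eq_one e.symm
  · have e := key _ (iN.toCoalgHom.comp (act m (fstC k T N) (sndC k T N)))
      (iT.toCoalgHom.comp (fstC k T N))
    rw [h.snd_inclN, hu.one_left] at e
    have e' := key _ (iT.toCoalgHom.comp (fstC k T N)) (iN.toCoalgHom.comp (sndC k T N))
    rw [h.snd_inclT, h.fst_inclN, h.straighten, eq_mul_of_cob_eq_one e.symm, mul_inv,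
      inv_mul_cancel_right] at e'
    exact e'

lemma PtSmash.res_inclN_mul_cob [Coalgebra.IsCocomm k N] [Coalgebra.IsCocomm k H]
    (h : PtSmash m iN iT pN pT) {u : Reg (k := k) (T ⊗[k] N) A}
    (hu : PtMeasZ1 m u) (t : Reg (k := k) H A) :
    pull (Coalgebra.TensorProduct.map iN.toCoalgHom iN.toCoalgHom)
      (pull (Coalgebra.TensorProduct.map pT pN) u * cob t) = cob (pull iN.toCoalgHom t) := by
  apply reg_ext_ev
  rw [ev_pull_map, ev_mul, ev_pull_map, h.snd_inclN, hu.one_left, one_mul, ev_cob, ev_cob,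
    ← bialgHom_comp_cmul, pull_comp, pull_comp, pull_comp]

/-- A 2-cochain on a smash product that is trivial on `N ⊗ N`, `T ⊗ T` and `N ⊗ T`. -/
structure PtTrivial (iN : N →ₐc[k] H) (iT : T →ₐc[k] H) (v : Reg (k := k) (H ⊗[k] H) A) :
    Prop where
  nn : ∀ (X : Type) [AddCommGroup X] [Module k X] [Coalgebra k X] [Coalgebra.IsCocomm k X]
    (n n' : X →ₗc[k] N), ev v (iN.toCoalgHom.comp n) (iN.toCoalgHom.comp n') = 1
  tt : ∀ (X : Type) [AddCommGroup X] [Module k X] [Coalgebra k X] [Coalgebra.IsCocomm k X]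
    (t t' : X →ₗc[k] T), ev v (iT.toCoalgHom.comp t) (iT.toCoalgHom.comp t') = 1
  nt : ∀ (X : Type) [AddCommGroup X] [Module k X] [Coalgebra k X] [Coalgebra.IsCocomm k X]
    (n : X →ₗc[k] N) (t : X →ₗc[k] T), ev v (iN.toCoalgHom.comp n) (iT.toCoalgHom.comp t) = 1

section Trivial

variable {v : Reg (k := k) (H ⊗[k] H) A}
variable {X : Type} [AddCommGroup X] [Module k X] [Coalgebra k X] [Coalgebra.IsCocomm k X]

lemma PtSmash.ev_inclN (h : PtSmash m iN iT pN pT) (hv : PtZ2 v) (hv' : PtTrivial iN iT v)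
    (n : X →ₗc[k] N) (x : X →ₗc[k] H) : ev v (iN.toCoalgHom.comp n) x = 1 := by
  have e := hv.cocycle X (iN.toCoalgHom.comp n) (iN.toCoalgHom.comp (pN.comp x))
    (iT.toCoalgHom.comp (pT.comp x))
  rw [hv'.nn, ← bialgHom_comp_cmul, hv'.nt, hv'.nt, h.split, one_mul, one_mul] at e
  exact e.symm

lemma PtSmash.ev_left (h : PtSmash m iN iT pN pT) (hv : PtZ2 v) (hv' : PtTrivial iN iT v)
    (x y : X →ₗc[k] H) : ev v x y = ev v (iT.toCoalgHom.comp (pT.comp x)) y := by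
  have e := hv.cocycle X (iN.toCoalgHom.comp (pN.comp x)) (iT.toCoalgHom.comp (pT.comp x)) y
  rwa [hv'.nt, h.split, h.ev_inclN hv hv', one_mul, mul_one] at e

lemma PtSmash.ev_right (h : PtSmash m iN iT pN pT) (hv : PtZ2 v) (hv' : PtTrivial iN iT v)
    (x y : X →ₗc[k] H) : ev v x y = ev v x (iN.toCoalgHom.comp (pN.comp y)) := by
  have e := hv.cocycle X x (iN.toCoalgHom.comp (pN.comp y)) (iT.toCoalgHom.comp (pT.comp y))
  rw [hv'.nt, h.split, h.ev_left hv hv' (cmul _ _), hv'.tt, one_mul, mul_one] at e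
  exact e.symm

end Trivial

lemma PtSmash.eq_pull_of_ptTrivial [Coalgebra.IsCocomm k H] (h : PtSmash m iN iT pN pT)
    {v : Reg (k := k) (H ⊗[k] H) A} (hv : PtZ2 v) (hv' : PtTrivial iN iT v) :
    v = pull (Coalgebra.TensorProduct.map pT pN)
      (pull (Coalgebra.TensorProduct.map iT.toCoalgHom iN.toCoalgHom) v) := by
  apply reg_ext_ev
  rw [ev_pull_map, ev_pull_map, ← h.ev_left hv hv', ← h.ev_right hv hv']

lemma PtSmash.ptMeasZ1_of_ptTrivial (h : PtSmash m iN iT pN pT)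
    {v : Reg (k := k) (H ⊗[k] H) A} (hv : PtZ2 v) (hv' : PtTrivial iN iT v) :
    PtMeasZ1 m (pull (Coalgebra.TensorProduct.map iT.toCoalgHom iN.toCoalgHom) v) where
  mul_right X _ _ _ _ t n n' := by
    simp only [ev_pull_map]
    have e := hv.cocycle X (iT.toCoalgHom.comp t) (iN.toCoalgHom.comp n)
      (iN.toCoalgHom.comp n')
    rw [hv'.nn, h.ev_left hv hv' (cmul _ _), h.snd_comp_cmul, h.snd_inclT, h.snd_inclN,
      cmul_cone, one_mul, ← bialgHom_comp_cmul] at e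
    exact e.symm
  one_right X _ _ _ _ t := by rw [ev_pull_map, bialgHom_comp_cone, hv.one_right]
  one_left X _ _ _ _ n := by rw [ev_pull_map, bialgHom_comp_cone, hv.one_left]
  cocycle X _ _ _ _ t s n := by
    simp only [ev_pull_map]
    have e := hv.cocycle X (iT.toCoalgHom.comp t) (iT.toCoalgHom.comp s)
      (iN.toCoalgHom.comp n)
    rw [hv'.tt, h.ev_right hv hv' _ (cmul _ _), h.fst_comp_cmul, h.snd_inclT, h.fst_inclT,
      h.fst_inclN, cone_cmul, one_mul, ← bialgHom_comp_cmul] at e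
    exact e

/-- A 2-cocycle on a smash product whose restrictions to `N` and `T` are coboundaries becomes
trivial on `N ⊗ N`, `T ⊗ T` and `N ⊗ T` after dividing by a coboundary. -/
lemma PtSmash.exists_ptTrivial_div [Coalgebra.IsCocomm k T] [Coalgebra.IsCocomm k N]
    [Coalgebra.IsCocomm k H] (h : PtSmash m iN iT pN pT)
    {u : Reg (k := k) (H ⊗[k] H) A} (hu : PtZ2 u)
    (a : Reg (k := k) T A) (ha : Normalized1 a.lin)
    (hTT : pull (Coalgebra.TensorProduct.map iT.toCoalgHom iT.toCoalgHom) u = cob a)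
    (b : Reg (k := k) N A) (hb : Normalized1 b.lin)
    (hNN : pull (Coalgebra.TensorProduct.map iN.toCoalgHom iN.toCoalgHom) u = cob b) :
    ∃ s : Reg (k := k) H A, Normalized1 s.lin ∧ PtTrivial iN iT (u / cob s) := by
  let s : Reg (k := k) H A :=
    (ev u (iN.toCoalgHom.comp pN) (iT.toCoalgHom.comp pT))⁻¹ * (pull pN b * pull pT a)
  have hs (X : Type) [AddCommGroup X] [Module k X] [Coalgebra k X] [Coalgebra.IsCocomm k X]
      (x : X →ₗc[k] H) : pull x s
        = (ev u (iN.toCoalgHom.comp (pN.comp x)) (iT.toCoalgHom.comp (pT.comp x)))⁻¹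
          * (pull (pN.comp x) b * pull (pT.comp x) a) := by
    simp only [s, map_mul, map_inv, pull_ev, pull_comp, CoalgHom.comp_assoc]
  have hsN (X : Type) [AddCommGroup X] [Module k X] [Coalgebra k X] [Coalgebra.IsCocomm k X]
      (n : X →ₗc[k] N) : pull (iN.toCoalgHom.comp n) s = pull n b := by
    rw [hs, h.fst_inclN, h.snd_inclN, bialgHom_comp_cone, hu.one_right, pull_cone a ha, inv_one,
      one_mul, mul_one]
  have hsT (X : Type) [AddCommGroup X] [Module k X] [Coalgebra k X] [Coalgebra.IsCocomm k X]
      (t : X →ₗc[k] T) : pull (iT.toCoalgHom.comp t) s = pull t a := by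
    rw [hs, h.fst_inclT, h.snd_inclT, bialgHom_comp_cone, hu.one_left, pull_cone b hb, inv_one,
      one_mul, one_mul]
  refine ⟨s, ?_, ?_, ?_, ?_⟩
  · have e := hsN H cone
    rw [bialgHom_comp_cone, pull_cone b hb, reg_eq_one_iff] at e
    have e' := e 1
    rw [lin_pull] at e'
    simpa [Normalized1] using e'
  · intro X _ _ _ _ n n'
    rw [ev_div, ← ev_pull_map, hNN, ev_cob, ev_cob, ← bialgHom_comp_cmul, hsN, hsN, hsN, div_self']
  · intro X _ _ _ _ t t'
    rw [ev_div, ← ev_pull_map, hTT, ev_cob, ev_cob, ← bialgHom_comp_cmul, hsT, hsT, hsT, div_self']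
  · intro X _ _ _ _ n t
    rw [ev_div, ev_cob, hsN, hsT, hs, h.fst_cmul, h.snd_cmul, div_eq_one]
    apply Additive.ofMul.injective
    simp only [ofMul_mul, ofMul_inv]
    abel

end Iota

end SmashPaper

/-- **The injection `ι : H¹_meas(T,Hom(N,A)) → H̃²(H,A)` and exactness at `H̃²(H,A)`.**
Let `H = N ⋊ T` (cocommutative Hopf algebras over `k`) act trivially on the commutative
`k`-algebra `A`.  The map `ι` sending a measuring 1-cocycle `f` to (the class of) the
Sweedler 2-cocycle `(n⋊t) ⊗ (n'⋊t') ↦ ε(n) f(t)(n') ε(t')` induces an injective group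
homomorphism `H¹_meas(T,Hom(N,A)) → H̃²(H,A)`, and a class `c ∈ H̃²(H,A)` restricts to
the trivial class in `H²(N,A)` if and only if `c` lies in the image of `ι`. -/
theorem iota_injective_image_ker_res
    {k : Type} [Field k] {T N H A : Type}
    [Ring T] [HopfAlgebra k T] [Ring N] [HopfAlgebra k N]
    [Ring H] [HopfAlgebra k H] [CommRing A] [Algebra k A]
    (hTcc : IsCocomm k T) (hNcc : IsCocomm k N)
    (μ : T ⊗[k] N →ₗ[k] N) (iN : N →ₐc[k] H) (iT : T →ₐc[k] H)
    (hsmash : IsSmashProduct μ iN iT) :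
    -- existence of `ι f`
    (∀ f : T ⊗[k] N →ₗ[k] A, ∃ F, IotaOf iN iT f F)
    -- `ι f` is a 2-cocycle whose restriction to `T` is a coboundary
    ∧ (∀ (f : T ⊗[k] N →ₗ[k] A) (F : H ⊗[k] H →ₗ[k] A),
        IsMeasZ1 μ f → IotaOf iN iT f F → IsZ2 F ∧ IsB2 (resTT iT F))
    -- `ι` is compatible with convolution products (a group homomorphism)
    ∧ (∀ (f f' : T ⊗[k] N →ₗ[k] A) (F F' : H ⊗[k] H →ₗ[k] A),
        IotaOf iN iT f F → IotaOf iN iT f' F' → IotaOf iN iT (conv f f') (conv F F'))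
    -- injectivity of `ι`
    ∧ (∀ (f : T ⊗[k] N →ₗ[k] A) (F : H ⊗[k] H →ₗ[k] A),
        IsMeasZ1 μ f → IotaOf iN iT f F → IsB2 F → IsMeasB1 μ f)
    -- image of `ι` = kernel of the restriction `H̃²(H,A) → H²(N,A)`
    ∧ (∀ F : H ⊗[k] H →ₗ[k] A,
        IsZ2 F → IsB2 (resTT iT F) →
          (IsB2 (resNN iN F) ↔
            ∃ (f : T ⊗[k] N →ₗ[k] A) (F' : H ⊗[k] H →ₗ[k] A),
              IsMeasZ1 μ f ∧ IotaOf iN iT f F' ∧ Cohomologous2 F F')) := by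
  have : Coalgebra.IsCocomm k T := ⟨hTcc⟩
  have : Coalgebra.IsCocomm k N := ⟨hNcc⟩
  obtain ⟨m, rfl⟩ := exists_coalgHom_of_isModuleBialgebra hsmash.act
  obtain ⟨hHcc, pN, pT, h⟩ := exists_ptSmash m iN iT hsmash
  refine ⟨fun f => ⟨_, (h.iotaOf_iff hsmash f _).2 rfl⟩, fun f F hf hF => ?_,
    fun f f' F F' hF hF' => ?_, fun f F hf hF hB => ?_, fun F hZ hTT => ?_⟩
  · obtain ⟨g, hg⟩ := hf.1.2.2
    obtain ⟨u, rfl, -⟩ := exists_reg_of_isConvInv hg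
    rw [isMeasZ1_iff] at hf
    rw [h.iotaOf_iff hsmash, ← lin_pull] at hF
    subst hF
    refine ⟨(isZ2_iff _).2 (h.ptZ2 hf), (isB2_iff _).2 ⟨1, ?_, ?_⟩⟩
    · simp [Normalized1, Reg.lin_one, convOne]
    · exact congrArg Reg.lin (h.res_inclT hf)
  · rw [h.iotaOf_iff hsmash] at hF hF' ⊢
    subst hF hF'
    exact (LinearMap.convMul_comp_coalgHom_distrib (WithConv.toConv f) (WithConv.toConv f') _).symm
  · obtain ⟨g, hg⟩ := hf.1.2.2
    obtain ⟨u, rfl, -⟩ := exists_reg_of_isConvInv hg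
    rw [isMeasZ1_iff] at hf
    rw [h.iotaOf_iff hsmash, ← lin_pull] at hF
    subst hF
    obtain ⟨t, ht, hB⟩ := (isB2_iff _).1 hB
    exact h.isMeasB1 hf t ht (Reg.lin_injective hB)
  · obtain ⟨G, hG⟩ := hZ.2.1
    obtain ⟨u, rfl, -⟩ := exists_reg_of_isConvInv hG
    rw [isZ2_iff] at hZ
    obtain ⟨a, ha, hTT⟩ := (isB2_iff _).1 hTT
    constructor
    · intro hNN
      obtain ⟨b, hb, hNN⟩ := (isB2_iff _).1 hNN
      obtain ⟨s, hs, htriv⟩ := h.exists_ptTrivial_div hZ a ha (Reg.lin_injective hTT) b hb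
        (Reg.lin_injective hNN)
      have hV := hZ.div (ptZ2_cob s hs)
      refine ⟨_, (u / cob s).lin, (isMeasZ1_iff _ _).2 (h.ptMeasZ1_of_ptTrivial hV htriv),
        (h.iotaOf_iff hsmash _ _).2 (congrArg Reg.lin (h.eq_pull_of_ptTrivial hV htriv)),
        (cob s).lin, (isB2_iff _).2 ⟨s, hs, rfl⟩, ?_⟩
      rw [← Reg.lin_mul, div_mul_cancel]
    · rintro ⟨f, F', hf, hF, b, hb, hU⟩
      obtain ⟨g, hg⟩ := hf.1.2.2
      obtain ⟨w, rfl, -⟩ := exists_reg_of_isConvInv hg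
      rw [isMeasZ1_iff] at hf
      rw [h.iotaOf_iff hsmash, ← lin_pull] at hF
      subst hF
      obtain ⟨t, ht, rfl⟩ := (isB2_iff _).1 hb
      rw [← Reg.lin_mul] at hU
      obtain rfl := Reg.lin_injective hU
      refine (isB2_iff _).2 ⟨pull iN.toCoalgHom t, ?_, congrArg Reg.lin
        (h.res_inclN_mul_cob hf t)⟩
      exact (congrArg t.lin (map_one iN)).trans ht
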